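/- Suppose there exists a constant C₁ > 0 such that the Poincaré inequality μ_V(f²) ≤ C₁ · 𝓔_{α,V}(f,f) holds for every f ∈ C_b^∞(ℝ^d) with μ_V(f) = 0. Then there exists a constant λ₀ > 0 such that ∫ e^{λ₀|x|} μ_V(dx) < ∞. -/

import Mathlib

open MeasureTheory Real Set Metric Filter

noncomputable section

/-- Euclidean space `ℝ^d`. -/
abbrev Ed (d : ℕ) := EuclideanSpace ℝ (Fin d)

/-- The probability measure `μ_V(dx) = C_V e^{-V(x)} dx` with `C_V = (∫ e^{-V})⁻¹`. -/
def muV (d : ℕ) (V : Ed d → ℝ) : Measure (Ed d) :=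
  (volume : Measure (Ed d)).withDensity
    fun x => ENNReal.ofReal ((∫ y, Real.exp (-V y))⁻¹ * Real.exp (-V x))

/-- `f ∈ C_b^∞(ℝ^d)`: smooth with bounded derivatives of every order. -/
def CbSmooth (d : ℕ) (f : Ed d → ℝ) : Prop :=
  ContDiff ℝ (⊤ : ℕ∞) f ∧ ∀ n : ℕ, ∃ C : ℝ, ∀ x, ‖iteratedFDeriv ℝ n f x‖ ≤ C

/-- `V` is locally bounded. -/
def LocallyBounded (d : ℕ) (V : Ed d → ℝ) : Prop :=
  ∀ r : ℝ, ∃ M : ℝ, ∀ x : Ed d, ‖x‖ ≤ r → |V x| ≤ M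

/-- The nonlocal Dirichlet form with finite range jumps `𝓔_{α,V}`. -/
def formE (d : ℕ) (α : ℝ) (V f : Ed d → ℝ) : ℝ :=
  (1/2) * ∫ x, (∫ y in {y : Ed d | dist x y ≤ 1},
      (f x - f y) ^ 2 / dist x y ^ ((d : ℝ) + α)) ∂(muV d V)

/-- The nonlocal Dirichlet form with large jumps `𝓓_{α,V}`. -/
def formD (d : ℕ) (α : ℝ) (V f : Ed d → ℝ) : ℝ :=
  (1/2) * ∫ x, (∫ y in {y : Ed d | 1 < dist x y},
      (f x - f y) ^ 2 / dist x y ^ ((d : ℝ) + α)) ∂(muV d V)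

/-- `inf_{z : |x|-1 ≤ |z| ≤ |x|-1/2} e^{-V(z)}`. -/
def infAnn (d : ℕ) (V : Ed d → ℝ) (x : Ed d) : ℝ :=
  sInf ((fun z => Real.exp (-V z)) '' {z : Ed d | ‖x‖ - 1 ≤ ‖z‖ ∧ ‖z‖ ≤ ‖x‖ - 1/2})

/-- `sup_{z : |x| ≤ |z| ≤ |x|+1} e^{-V(z)}`. -/
def supAnn (d : ℕ) (V : Ed d → ℝ) (x : Ed d) : ℝ :=
  sSup ((fun z => Real.exp (-V z)) '' {z : Ed d | ‖x‖ ≤ ‖z‖ ∧ ‖z‖ ≤ ‖x‖ + 1})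

/-- `K(r) = sup_{|x| ≤ r} e^{-V(x)}`. -/
def Kfun (d : ℕ) (V : Ed d → ℝ) (r : ℝ) : ℝ :=
  sSup ((fun x => Real.exp (-V x)) '' {x : Ed d | ‖x‖ ≤ r})

/-- `k(r) = inf_{|x| ≤ r+1} e^{-V(x)}`. -/
def kfun (d : ℕ) (V : Ed d → ℝ) (r : ℝ) : ℝ :=
  sInf ((fun x => Real.exp (-V x)) '' {x : Ed d | ‖x‖ ≤ r + 1})

/-- The constant `(1/α)·2^{2d+1}·(e + e^{1/2})·(2^α − 1)`. -/
def thresholdConst (d : ℕ) (α : ℝ) : ℝ :=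
  (1/α) * (2:ℝ) ^ (2*d+1) * (Real.exp 1 + Real.exp (1/2)) * ((2:ℝ) ^ α - 1)

/-- The function `x ↦ √(1 + ‖x‖²)` is `1`-Lipschitz. -/
lemma abs_sqrt_one_add_norm_sq_sub_le {E : Type*} [SeminormedAddCommGroup E] (x y : E) :
    |√(1 + ‖x‖ ^ 2) - √(1 + ‖y‖ ^ 2)| ≤ ‖x - y‖ := by
  have key : ∀ a b : ℝ, |√(1 + a ^ 2) - √(1 + b ^ 2)| ≤ |a - b| := by
    intro a b
    have ha : 0 ≤ 1 + a ^ 2 := by positivity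
    have hb : 0 ≤ 1 + b ^ 2 := by positivity
    have hab : 1 + a * b ≤ √(1 + a ^ 2) * √(1 + b ^ 2) := by
      rw [← Real.sqrt_mul ha]
      apply Real.le_sqrt_of_sq_le
      nlinarith [sq_nonneg (a - b)]
    apply sq_le_sq.mp
    nlinarith [Real.sq_sqrt ha, Real.sq_sqrt hb]
  exact (key _ _).trans (abs_norm_sub_norm_le x y)

lemma norm_le_sqrt_one_add_norm_sq {E : Type*} [SeminormedAddCommGroup E] (x : E) :
    ‖x‖ ≤ √(1 + ‖x‖ ^ 2) :=
  Real.le_sqrt_of_sq_le (by linarith)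

/-- A compactly supported smooth function on `ℝ` agreeing with the identity on `[-1, 1]`. -/
lemma exists_contDiff_hasCompactSupport_eq_id :
    ∃ g : ℝ → ℝ, ContDiff ℝ (⊤ : ℕ∞) g ∧ HasCompactSupport g ∧
      (∀ t, |t| ≤ 1 → g t = t) ∧ ∀ t, 0 ≤ t → g t ≤ t := by
  let b : ContDiffBump (0 : ℝ) := ⟨1, 2, one_pos, one_lt_two⟩
  refine ⟨fun t => t * b t, contDiff_id.mul b.contDiff, b.hasCompactSupport.mul_left, ?_, ?_⟩
  · intro t ht
    have : b t = 1 := b.one_of_mem_closedBall (by simpa [b] using ht)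
    simp [this]
  · intro t ht
    exact mul_le_of_le_one_right ht b.le_one

/-- Smooth compactly supported, uniformly Lipschitz truncations of the norm. -/
lemma exists_smooth_truncation_norm (E : Type*) [NormedAddCommGroup E] [InnerProductSpace ℝ E]
    [FiniteDimensional ℝ E] :
    ∃ (φ : ℕ → E → ℝ) (L : ℝ), 0 ≤ L ∧ (∀ n, ContDiff ℝ (⊤ : ℕ∞) (φ n)) ∧
      (∀ n, HasCompactSupport (φ n)) ∧ (∀ n x y, |φ n x - φ n y| ≤ L * ‖x - y‖) ∧
      (∀ n x, φ n x ≤ 1 + ‖x‖) ∧ ∀ x, ∀ᶠ n in atTop, ‖x‖ ≤ φ n x := by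
  obtain ⟨g, hg, hgc, hgid, hgle⟩ := exists_contDiff_hasCompactSupport_eq_id
  obtain ⟨L, hL⟩ := hg.lipschitzWith_of_hasCompactSupport hgc (by simp)
  let N : ℕ → ℝ := fun n => (n : ℝ) + 1
  have hN : ∀ n, 0 < N n := fun n => by positivity
  have hsqrt : ContDiff ℝ (⊤ : ℕ∞) fun x : E => √(1 + ‖x‖ ^ 2) :=
    (contDiff_const.add (contDiff_norm_sq ℝ)).sqrt fun x => by positivity
  refine ⟨fun n x => N n * g (√(1 + ‖x‖ ^ 2) / N n), L, L.2, ?_, ?_, ?_, ?_, ?_⟩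
  · intro n
    exact contDiff_const.mul (hg.comp (hsqrt.div_const _))
  · intro n
    obtain ⟨R, hR⟩ := hgc.isCompact.isBounded.exists_norm_le
    refine HasCompactSupport.of_support_subset_isCompact
      (isCompact_closedBall (0 : E) (R * N n)) fun x hx => ?_
    have h1 : g (√(1 + ‖x‖ ^ 2) / N n) ≠ 0 := right_ne_zero_of_mul hx
    have h2 := hR _ (subset_tsupport _ h1)
    rw [Real.norm_of_nonneg (by have := hN n; positivity), div_le_iff₀ (hN n)] at h2
    simpa using (norm_le_sqrt_one_add_norm_sq x).trans h2
  · intro n x y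
    have h := hL.dist_le_mul (√(1 + ‖x‖ ^ 2) / N n) (√(1 + ‖y‖ ^ 2) / N n)
    rw [Real.dist_eq, Real.dist_eq, ← sub_div, abs_div, abs_of_pos (hN n)] at h
    have h2 := abs_sqrt_one_add_norm_sq_sub_le x y
    rw [← mul_sub, abs_mul, abs_of_pos (hN n)]
    calc _ ≤ N n * (L * (|√(1 + ‖x‖ ^ 2) - √(1 + ‖y‖ ^ 2)| / N n)) := by
          have := hN n; gcongr
      _ = L * |√(1 + ‖x‖ ^ 2) - √(1 + ‖y‖ ^ 2)| := by
          have := (hN n).ne'; field_simp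
      _ ≤ _ := by gcongr
  · intro n x
    have h := hgle (√(1 + ‖x‖ ^ 2) / N n) (by have := hN n; positivity)
    rw [le_div_iff₀ (hN n)] at h
    linarith [sqrt_one_add_norm_sq_le x]
  · intro x
    filter_upwards [eventually_ge_atTop ⌈√(1 + ‖x‖ ^ 2)⌉₊] with n hn
    have h1 : √(1 + ‖x‖ ^ 2) ≤ N n := (Nat.le_ceil _).trans (by
      have : (⌈√(1 + ‖x‖ ^ 2)⌉₊ : ℝ) ≤ n := by exact_mod_cast hn
      exact this.trans (by simp [N]))
    have h0 : 0 ≤ √(1 + ‖x‖ ^ 2) / N n := by have := hN n; positivity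
    rw [hgid _ (by rwa [abs_of_nonneg h0, div_le_one (hN n)]), mul_div_cancel₀ _ (hN n).ne']
    exact norm_le_sqrt_one_add_norm_sq x

/-- A smooth compactly supported function plus a constant lies in `C_b^∞`. -/
lemma CbSmooth.of_hasCompactSupport_add_const {d : ℕ} {F : Ed d → ℝ}
    (hF : ContDiff ℝ (⊤ : ℕ∞) F) (hc : HasCompactSupport F) (c : ℝ) :
    CbSmooth d (fun x => F x + c) := by
  refine ⟨hF.add contDiff_const, fun n => ?_⟩
  obtain ⟨C, hC⟩ := (hF.continuous_iteratedFDeriv (m := n)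
    (by exact_mod_cast le_top)).bounded_above_of_compact_support (hc.iteratedFDeriv (𝕜 := ℝ) n)
  obtain ⟨D, hD⟩ : ∃ D : ℝ, ∀ x, ‖iteratedFDeriv ℝ n (fun _ : Ed d => c) x‖ ≤ D := by
    rcases eq_or_ne n 0 with rfl | hn
    · exact ⟨‖c‖, fun x => by simp⟩
    · exact ⟨0, fun x => by simp [iteratedFDeriv_const_of_ne hn]⟩
  refine ⟨C + D, fun x => ?_⟩
  have hadd : iteratedFDeriv ℝ n (fun x => F x + c) x =
      iteratedFDeriv ℝ n F x + iteratedFDeriv ℝ n (fun _ => c) x :=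
    fun_iteratedFDeriv_add_apply (hF.contDiffAt.of_le (by exact_mod_cast le_top))
      contDiffAt_const
  rw [hadd]
  exact (norm_add_le _ _).trans (add_le_add (hC x) (hD x))

lemma isProbabilityMeasure_muV {d : ℕ} {V : Ed d → ℝ}
    (hVint : Integrable (fun x => Real.exp (-V x))) : IsProbabilityMeasure (muV d V) := by
  constructor
  have hpos := integral_exp_pos hVint
  rw [muV, withDensity_apply _ MeasurableSet.univ, Measure.restrict_univ,
    ← ofReal_integral_eq_lintegral_ofReal (hVint.const_mul _)
      (ae_of_all _ fun x => by positivity), integral_const_mul, inv_mul_cancel₀ hpos.ne',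
    ENNReal.ofReal_one]

/-- The kernel `|z|^{2-d-α}` on the closed unit ball. -/
def unitBallKernel (d : ℕ) (α : ℝ) : Ed d → ℝ :=
  (closedBall (0 : Ed d) 1).indicator fun z => ‖z‖ ^ (2 - ((d : ℝ) + α))

lemma unitBallKernel_nonneg (d : ℕ) (α : ℝ) (z : Ed d) : 0 ≤ unitBallKernel d α z :=
  indicator_nonneg (fun _ _ => by positivity) z

lemma integrable_unitBallKernel {d : ℕ} (hd : 1 ≤ d) {α : ℝ} (hα : α < 2) :
    Integrable (unitBallKernel d α) := by
  have : Nonempty (Fin d) := ⟨⟨0, hd⟩⟩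
  rw [unitBallKernel, integrable_indicator_iff measurableSet_closedBall]
  refine IntegrableOn.mono_set ?_ (closedBall_subset_ball (one_lt_two : (1 : ℝ) < 2))
  rw [integrableOn_fun_norm_addHaar volume (f := fun t : ℝ => t ^ (2 - ((d : ℝ) + α)))]
  have h : IntegrableOn (fun t : ℝ => t ^ (1 - α)) (Ioo 0 2) :=
    (intervalIntegral.integrableOn_Ioo_rpow_iff two_pos).2 (by linarith)
  refine h.congr_fun (fun t ht => ?_) measurableSet_Ioo
  simp only [finrank_euclideanSpace, Fintype.card_fin, smul_eq_mul]
  rw [← Real.rpow_natCast, ← Real.rpow_add ht.1]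
  congr 1
  push_cast [Nat.cast_sub hd]
  ring

/-- Energy bound for exponentials of Lipschitz functions with small Lipschitz constant. -/
lemma formE_exp_le {d : ℕ} (hd : 1 ≤ d) {α : ℝ} (hα : α < 2) {V : Ed d → ℝ} {ψ : Ed d → ℝ}
    {L : ℝ} (hL1 : L ≤ 1) (hψ : ∀ x y, |ψ x - ψ y| ≤ L * ‖x - y‖) (c : ℝ)
    (hint : Integrable (fun x => Real.exp (ψ x) ^ 2) (muV d V)) :
    formE d α V (fun x => Real.exp (ψ x) + c) ≤
      2 * L ^ 2 * (∫ z, unitBallKernel d α z) * ∫ x, Real.exp (ψ x) ^ 2 ∂(muV d V) := by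
  have hsq : ∀ x y, dist x y ≤ 1 →
      ((Real.exp (ψ x) + c) - (Real.exp (ψ y) + c)) ^ 2 ≤
        4 * L ^ 2 * Real.exp (ψ x) ^ 2 * dist x y ^ 2 := by
    intro x y hxy
    have h1 : |ψ y - ψ x| ≤ L * dist x y := by
      rw [abs_sub_comm, dist_eq_norm]; exact hψ x y
    have h2 : |ψ y - ψ x| ≤ 1 := h1.trans (mul_le_one₀ hL1 dist_nonneg hxy)
    have h3 := (Real.abs_exp_sub_one_le h2).trans (mul_le_mul_of_nonneg_left h1 zero_le_two)
    have h4 : (Real.exp (ψ x) + c) - (Real.exp (ψ y) + c) =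
        -(Real.exp (ψ x) * (Real.exp (ψ y - ψ x) - 1)) := by
      rw [mul_sub, ← Real.exp_add]; ring_nf
    rw [h4, neg_sq, mul_pow, ← sq_abs (Real.exp (ψ y - ψ x) - 1)]
    calc _ ≤ Real.exp (ψ x) ^ 2 * (2 * (L * dist x y)) ^ 2 := by gcongr
      _ = _ := by ring
  have hinner : ∀ x, (∫ y in {y : Ed d | dist x y ≤ 1},
      ((Real.exp (ψ x) + c) - (Real.exp (ψ y) + c)) ^ 2 / dist x y ^ ((d : ℝ) + α)) ≤
      4 * L ^ 2 * (∫ z, unitBallKernel d α z) * Real.exp (ψ x) ^ 2 := by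
    intro x
    have hmeas : MeasurableSet {y : Ed d | dist x y ≤ 1} :=
      (isClosed_le (continuous_const.dist continuous_id) continuous_const).measurableSet
    have hker := integrable_unitBallKernel hd hα
    rw [← integral_indicator hmeas]
    calc _ ≤ ∫ y, 4 * L ^ 2 * Real.exp (ψ x) ^ 2 * unitBallKernel d α (x - y) := by
          refine integral_mono_of_nonneg
            (ae_of_all _ fun y => indicator_nonneg (fun _ _ => by positivity) y)
            ((hker.comp_sub_left x).const_mul _) (ae_of_all _ fun y => ?_)
          by_cases hy : dist x y ≤ 1
          · have hy' : x - y ∈ closedBall (0 : Ed d) 1 := by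
              simpa [dist_eq_norm] using hy
            simp only [unitBallKernel]
            rw [indicator_of_mem hy', indicator_of_mem (show y ∈ {y | dist x y ≤ 1} from hy),
              ← dist_eq_norm]
            rcases eq_or_lt_of_le (dist_nonneg (x := x) (y := y)) with h0 | h0
            · have : x = y := dist_eq_zero.1 h0.symm
              subst this
              simp only [sub_self, ne_eq, OfNat.ofNat_ne_zero, not_false_eq_true, zero_pow,
                zero_div]
              positivity
            · rw [Real.rpow_sub h0, ← mul_div_assoc]
              gcongr
              simpa using hsq x y hy
          · rw [indicator_of_notMem (show y ∉ {y | dist x y ≤ 1} from hy)]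
            exact mul_nonneg (by positivity) (unitBallKernel_nonneg _ _ _)
      _ = _ := by
          rw [integral_const_mul, integral_sub_left_eq_self (unitBallKernel d α) volume x]
          ring
  have houter := integral_mono_of_nonneg (μ := muV d V)
    (ae_of_all _ fun x => setIntegral_nonneg_of_ae (ae_of_all _ fun y => by positivity))
    (hint.const_mul (4 * L ^ 2 * ∫ z, unitBallKernel d α z)) (ae_of_all _ hinner)
  rw [integral_const_mul] at houter
  rw [formE]
  linarith

/-- If `μ(f²) ≤ 2 μ(f)²` and `f ≤ M` off a set of measure at most `1/4`, then `μ(f²) ≤ 32 M²`. -/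
lemma integral_sq_le_of_le_two_mul_sq_integral {Ω : Type*} [MeasurableSpace Ω] {μ : Measure Ω}
    [IsProbabilityMeasure μ] {f : Ω → ℝ} {M : ℝ} {s : Set Ω} (hM : 0 ≤ M)
    (hf : Integrable f μ) (hf2 : Integrable (fun x => f x ^ 2) μ)
    (hpos : 0 < ∫ x, f x ∂μ) (h : ∫ x, f x ^ 2 ∂μ ≤ 2 * (∫ x, f x ∂μ) ^ 2)
    (hs : MeasurableSet s) (hsM : ∀ x ∉ s, f x ≤ M) (hμs : μ.real s ≤ 1 / 4) :
    ∫ x, f x ^ 2 ∂μ ≤ 32 * M ^ 2 := by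
  set m := ∫ x, f x ∂μ with hm
  set q := ∫ x, f x ^ 2 ∂μ with hq
  have hpt : ∀ x, f x ≤ M + f x ^ 2 / (4 * m) + s.indicator (fun _ => m) x := by
    intro x
    by_cases hx : x ∈ s
    · rw [indicator_of_mem hx]
      have : f x ^ 2 / (4 * m) + m - f x = (f x - 2 * m) ^ 2 / (4 * m) := by
        field_simp; ring
      have : 0 ≤ (f x - 2 * m) ^ 2 / (4 * m) := by positivity
      linarith
    · rw [indicator_of_notMem hx]
      have : 0 ≤ f x ^ 2 / (4 * m) := by positivity
      linarith [hsM x hx]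
  have hi1 : Integrable (fun x => M + f x ^ 2 / (4 * m)) μ :=
    (integrable_const _).add (hf2.div_const _)
  have hi2 : Integrable (s.indicator fun _ => m) μ := (integrable_const m).indicator hs
  have hle := integral_mono hf (hi1.add hi2) hpt
  simp only [Pi.add_apply] at hle
  rw [integral_add hi1 hi2, integral_add (integrable_const _) (hf2.div_const _),
    integral_div, integral_indicator_const _ hs] at hle
  simp only [integral_const, probReal_univ, smul_eq_mul, one_mul, ← hm, ← hq] at hle
  have hq2 : q / (4 * m) ≤ m / 2 := by
    rw [div_le_iff₀ (by positivity)]; linarith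
  have hm4 : m ≤ 4 * M := by nlinarith
  nlinarith

/-- Every finite measure gives small mass to the complement of a large ball. -/
lemma exists_measureReal_norm_gt_le {E : Type*} [NormedAddCommGroup E] [MeasurableSpace E]
    [BorelSpace E] [CompleteSpace E] [SecondCountableTopology E] (μ : Measure E)
    [IsFiniteMeasure μ] {ε : ℝ} (hε : 0 < ε) :
    ∃ R : ℝ, 0 ≤ R ∧ μ.real {x | R < ‖x‖} ≤ ε := by
  have h := tendsto_measure_norm_gt_of_isTightMeasureSet (isTightMeasureSet_singleton (μ := μ))
  simp only [mem_singleton_iff, iSup_iSup_eq_left] at h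
  obtain ⟨R, hR, hR0⟩ := ((h.eventually_le_const (ENNReal.ofReal_pos.2 hε)).and
    (eventually_ge_atTop 0)).exists
  exact ⟨R, hR0, ENNReal.toReal_le_of_le_ofReal hε.le hR⟩

/-- A function eventually dominated pointwise by a sequence with bounded integrals is integrable. -/
lemma integrable_of_eventually_le_of_integral_le {Ω : Type*} [MeasurableSpace Ω] {μ : Measure Ω}
    {F : Ω → ℝ} {G : ℕ → Ω → ℝ} {B : ℝ} (hF : AEStronglyMeasurable F μ) (hF0 : ∀ x, 0 ≤ F x)
    (hG0 : ∀ n x, 0 ≤ G n x) (hG : ∀ n, Measurable (G n)) (hGi : ∀ n, Integrable (G n) μ)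
    (hB : ∀ n, ∫ x, G n x ∂μ ≤ B) (hFG : ∀ x, ∀ᶠ n in atTop, F x ≤ G n x) :
    Integrable F μ := by
  refine ⟨hF, ?_⟩
  rw [hasFiniteIntegral_iff_ofReal (ae_of_all _ hF0)]
  calc ∫⁻ x, ENNReal.ofReal (F x) ∂μ
      ≤ ∫⁻ x, liminf (fun n => ENNReal.ofReal (G n x)) atTop ∂μ :=
        lintegral_mono fun x => le_liminf_of_le (by isBoundedDefault)
          ((hFG x).mono fun n hn => ENNReal.ofReal_le_ofReal hn)
    _ ≤ liminf (fun n => ∫⁻ x, ENNReal.ofReal (G n x) ∂μ) atTop :=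
        lintegral_liminf_le fun n => (hG n).ennreal_ofReal
    _ ≤ ENNReal.ofReal B := by
        refine liminf_le_of_le (by isBoundedDefault) fun b hb => ?_
        obtain ⟨n, hn⟩ := hb.exists
        rw [← ofReal_integral_eq_lintegral_ofReal (hGi n) (ae_of_all _ (hG0 n))] at hn
        exact hn.trans (ENNReal.ofReal_le_ofReal (hB n))
    _ < ⊤ := ENNReal.ofReal_lt_top

/-- the Poincaré inequality for `𝓔_{α,V}` implies exponential
integrability of `μ_V`. -/
theorem poincare_implies_exponential_integrability
    (d : ℕ) (hd : 1 ≤ d) (α : ℝ) (hα : 0 < α ∧ α < 2)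
    (V : Ed d → ℝ) (hVmeas : Measurable V) (hVloc : LocallyBounded d V)
    (hVint : Integrable (fun x => Real.exp (-V x)))
    (hPI : ∃ C₁ : ℝ, 0 < C₁ ∧ ∀ f : Ed d → ℝ, CbSmooth d f →
      (∫ x, f x ∂(muV d V)) = 0 →
      ∫ x, (f x) ^ 2 ∂(muV d V) ≤ C₁ * formE d α V f) :
    ∃ lam₀ : ℝ, 0 < lam₀ ∧
      Integrable (fun x : Ed d => Real.exp (lam₀ * ‖x‖)) (muV d V) := by
  obtain ⟨C₁, hC₁, hP⟩ := hPI
  have := isProbabilityMeasure_muV hVint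
  obtain ⟨φ, L, hL, hφs, hφc, hφL, hφle, hφev⟩ := exists_smooth_truncation_norm (Ed d)
  obtain ⟨R, hR0, hR⟩ := exists_measureReal_norm_gt_le (muV d V) (ε := 1 / 4) (by norm_num)
  set I := ∫ z, unitBallKernel d α z with hI
  have hI0 : 0 ≤ I := integral_nonneg (unitBallKernel_nonneg d α)
  obtain ⟨lam, hlam, hlamL, hlamI⟩ : ∃ lam : ℝ, 0 < lam ∧ lam * L ≤ 1 ∧
      C₁ * (2 * (lam * L) ^ 2 * I) ≤ 1 / 2 := by
    have h1 : Tendsto (fun l : ℝ => l * L) (nhdsWithin 0 (Ioi 0)) (nhds 0) :=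
      (Continuous.tendsto' (by fun_prop) _ _ (by simp)).mono_left nhdsWithin_le_nhds
    have h2 : Tendsto (fun l : ℝ => C₁ * (2 * (l * L) ^ 2 * I)) (nhdsWithin 0 (Ioi 0)) (nhds 0) :=
      (Continuous.tendsto' (by fun_prop) _ _ (by simp)).mono_left nhdsWithin_le_nhds
    obtain ⟨l, h3, h4, h5⟩ := ((eventually_mem_nhdsWithin (a := (0 : ℝ)) (s := Ioi 0)).and
      ((h1.eventually_le_const one_pos).and
        (h2.eventually_le_const (show (0 : ℝ) < 1 / 2 by norm_num)))).exists
    exact ⟨l, h3, h4, h5⟩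
  have hcont : ∀ n, Continuous fun x => Real.exp (lam * φ n x) := fun n =>
    Real.continuous_exp.comp (continuous_const.mul (hφs n).continuous)
  have hbdd : ∀ n, ∃ B, ∀ x, ‖Real.exp (lam * φ n x)‖ ≤ B := by
    intro n
    obtain ⟨B, hB⟩ := (hφs n).continuous.bounded_above_of_compact_support (hφc n)
    refine ⟨Real.exp (lam * B), fun x => ?_⟩
    rw [Real.norm_of_nonneg (Real.exp_pos _).le]
    have := (le_abs_self _).trans (hB x)
    gcongr
  have hint : ∀ n, Integrable (fun x => Real.exp (lam * φ n x)) (muV d V) := fun n =>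
    let ⟨B, hB⟩ := hbdd n
    Integrable.of_bound (hcont n).aestronglyMeasurable B (ae_of_all _ hB)
  have hint2 : ∀ n, Integrable (fun x => Real.exp (lam * φ n x) ^ 2) (muV d V) := fun n =>
    let ⟨B, hB⟩ := hbdd n
    Integrable.of_bound ((hcont n).pow 2).aestronglyMeasurable (B ^ 2) (ae_of_all _ fun x => by
      rw [norm_pow]; gcongr; exact hB x)
  have hbound : ∀ n, ∫ x, Real.exp (lam * φ n x) ^ 2 ∂(muV d V) ≤
      32 * Real.exp (lam * (1 + R)) ^ 2 := by
    intro n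
    refine integral_sq_le_of_le_two_mul_sq_integral (Real.exp_pos _).le (hint n) (hint2 n)
      (integral_exp_pos (hint n)) ?_ (s := {x | R < ‖x‖})
      (measurableSet_lt measurable_const measurable_norm) (fun x hx => ?_) hR
    · set m := ∫ x, Real.exp (lam * φ n x) ∂(muV d V) with hm
      have hsm : CbSmooth d (fun x => Real.exp (lam * φ n x) + -m) := by
        have h := CbSmooth.of_hasCompactSupport_add_const
          (F := fun x => Real.exp (lam * φ n x) - 1)
          ((contDiff_const.mul (hφs n)).exp.sub contDiff_const)
          ((hφc n).comp_left (g := fun t => Real.exp (lam * t) - 1) (by simp)) (1 - m)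
        convert h using 2 with x
        ring
      have hmean : ∫ x, (Real.exp (lam * φ n x) + -m) ∂(muV d V) = 0 := by
        rw [integral_add (hint n) (integrable_const _), ← hm]
        simp
      have hvar : ∫ x, (Real.exp (lam * φ n x) + -m) ^ 2 ∂(muV d V) =
          (∫ x, Real.exp (lam * φ n x) ^ 2 ∂(muV d V)) - m ^ 2 := by
        have h : ∀ x, (Real.exp (lam * φ n x) + -m) ^ 2 =
            Real.exp (lam * φ n x) ^ 2 - (2 * m * Real.exp (lam * φ n x) - m ^ 2) :=
          fun x => by ring
        have hi : Integrable (fun x => 2 * m * Real.exp (lam * φ n x) - m ^ 2) (muV d V) :=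
          ((hint n).const_mul _).sub (integrable_const _)
        simp_rw [h]
        rw [integral_sub (hint2 n) hi,
          integral_sub ((hint n).const_mul _) (integrable_const _), integral_const_mul, ← hm]
        simp only [integral_const, probReal_univ, one_smul]
        ring
      have hpoin := hP _ hsm hmean
      have hE := formE_exp_le hd hα.2 (V := V) (ψ := fun x => lam * φ n x) (L := lam * L)
        hlamL (fun x y => by
          rw [← mul_sub, abs_mul, abs_of_pos hlam, mul_assoc]
          gcongr
          exact hφL n x y) (-m) (hint2 n)
      have hq : 0 ≤ ∫ x, Real.exp (lam * φ n x) ^ 2 ∂(muV d V) :=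
        integral_nonneg fun x => by positivity
      rw [hvar] at hpoin
      nlinarith [mul_le_mul_of_nonneg_left hE hC₁.le, mul_le_mul_of_nonneg_right hlamI hq]
    · have hx' : ‖x‖ ≤ R := not_lt.1 hx
      have := hφle n x
      gcongr
      linarith
  refine ⟨2 * lam, by positivity, integrable_of_eventually_le_of_integral_le
    (Continuous.aestronglyMeasurable (by fun_prop)) (fun x => (Real.exp_pos _).le)
    (fun n x => sq_nonneg _) (fun n => ((hcont n).pow 2).measurable) hint2 hbound fun x => ?_⟩
  filter_upwards [hφev x] with n hn
  rw [← Real.exp_nat_mul]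
  push_cast
  rw [mul_assoc]
  gcongr
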